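/- For fixed m, the proportion, among all C(n + m! − 1, n) voting situations with n agents on A, of those in which the set of Tideman winners differs from the set of DQ winners tends to 0 as n → ∞. (Equivalently, under the Impartial Anonymous Culture assumption the probability that the Tideman and DQ rules pick the same set of winners converges to 1.) -/

import Mathlib

open Finset Filter

/-- A vote (strict linear order) on `m` alternatives, encoded by its position map:
`v x` is the position of alternative `x`, position `0` being the top.
`v` ranks `x` above `y` iff `v x < v y`. -/
abbrev Vote (m : ℕ) := Equiv.Perm (Fin m)

/-- A profile is a list of `n` votes, one per agent. -/
abbrev Profile (m n : ℕ) := Fin n → Vote m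

/-- `n_{xy}[P]`: the number of votes in `P` ranking `x` above `y`. -/
def nAbove {m n : ℕ} (P : Profile m n) (x y : Fin m) : ℕ :=
  (Finset.univ.filter (fun i => P i x < P i y)).card

/-- `adv[P](x,y) = max (0, n_{xy} - n_{yx})` (truncated subtraction on `ℕ`). -/
def adv {m n : ℕ} (P : Profile m n) (x y : Fin m) : ℕ :=
  nAbove P x y - nAbove P y x

/-- The Tideman score `Sc_T[P](a) = Σ_{b ≠ a} adv[P](b,a)`. -/
def ScT {m n : ℕ} (P : Profile m n) (a : Fin m) : ℕ :=
  ∑ b ∈ Finset.univ.filter (fun b => b ≠ a), adv P b a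

/-- The Dodgson Quick score `Sc_Q[P](a) = Σ_{b ≠ a} ⌈adv[P](b,a)/2⌉`. -/
def ScQ {m n : ℕ} (P : Profile m n) (a : Fin m) : ℕ :=
  ∑ b ∈ Finset.univ.filter (fun b => b ≠ a), (adv P b a + 1) / 2

/-- `a` is a Condorcet-tie winner of `P` iff `adv[P](b,a) = 0` for all `b ≠ a`. -/
def CondorcetTieWinner {m n : ℕ} (P : Profile m n) (a : Fin m) : Prop :=
  ∀ b, b ≠ a → adv P b a = 0

/-- `a` is a Condorcet winner of `P` iff `adv[P](a,b) > 0` for all `b ≠ a`. -/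
def CondorcetWinner {m n : ℕ} (P : Profile m n) (a : Fin m) : Prop :=
  ∀ b, b ≠ a → 0 < adv P a b

/-- `w` is obtained from the vote `v` by one swap of neighbouring alternatives
(the alternatives at consecutive positions `p` and `p+1` are exchanged). -/
def AdjSwapVote {m : ℕ} (v w : Vote m) : Prop :=
  ∃ p q : Fin m, (q : ℕ) = (p : ℕ) + 1 ∧ w = v.trans (Equiv.swap p q)

/-- `Q` is obtained from the profile `P` by one adjacent swap in one vote. -/
def AdjSwap {m n : ℕ} (P Q : Profile m n) : Prop :=
  ∃ i : Fin n, AdjSwapVote (P i) (Q i) ∧ ∀ j, j ≠ i → Q j = P j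

/-- `Reach r k P Q`: `Q` can be obtained from `P` by exactly `k` steps of `r`. -/
def Reach {α : Type*} (r : α → α → Prop) : ℕ → α → α → Prop
  | 0, P, Q => P = Q
  | (k+1), P, Q => ∃ R, r P R ∧ Reach r k R Q

/-- The Dodgson score `Sc_D[P](a)`: the minimum number of adjacent swaps needed to
transform `P` into a profile in which `a` is a Condorcet-tie winner. -/
noncomputable def ScD {m n : ℕ} (P : Profile m n) (a : Fin m) : ℕ :=
  sInf {k | ∃ Q, Reach AdjSwap k P Q ∧ CondorcetTieWinner Q a}

/-- Variant of the Dodgson score requiring `a` to become a Condorcet winner. -/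
noncomputable def ScD' {m n : ℕ} (P : Profile m n) (a : Fin m) : ℕ :=
  sInf {k | ∃ Q, Reach AdjSwap k P Q ∧ CondorcetWinner Q a}

/- Voting situations: multisets of votes.  Scores depend only on the voting
situation of a profile, so we define them directly on multisets. -/

/-- Number of votes in the voting situation `S` ranking `x` above `y`. -/
def snAbove {m : ℕ} (S : Multiset (Vote m)) (x y : Fin m) : ℕ :=
  (S.filter (fun v => v x < v y)).card

def sadv {m : ℕ} (S : Multiset (Vote m)) (x y : Fin m) : ℕ :=
  snAbove S x y - snAbove S y x

/-- Tideman score of a voting situation. -/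
def sScT {m : ℕ} (S : Multiset (Vote m)) (a : Fin m) : ℕ :=
  ∑ b ∈ Finset.univ.filter (fun b => b ≠ a), sadv S b a

/-- Dodgson Quick score of a voting situation. -/
def sScQ {m : ℕ} (S : Multiset (Vote m)) (a : Fin m) : ℕ :=
  ∑ b ∈ Finset.univ.filter (fun b => b ≠ a), (sadv S b a + 1) / 2

def sCondorcetTieWinner {m : ℕ} (S : Multiset (Vote m)) (a : Fin m) : Prop :=
  ∀ b, b ≠ a → sadv S b a = 0

/-- One adjacent swap applied to one vote of a voting situation. -/
def sAdjSwap {m : ℕ} (S T : Multiset (Vote m)) : Prop :=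
  ∃ v ∈ S, ∃ w, AdjSwapVote v w ∧ T = w ::ₘ S.erase v

/-- Dodgson score of a voting situation. -/
noncomputable def sScD {m : ℕ} (S : Multiset (Vote m)) (a : Fin m) : ℕ :=
  sInf {k | ∃ T, Reach sAdjSwap k S T ∧ sCondorcetTieWinner T a}

/-- `a` is a Tideman winner (minimal Tideman score). -/
def sTWinner {m : ℕ} (S : Multiset (Vote m)) (a : Fin m) : Prop :=
  ∀ b, sScT S a ≤ sScT S b

/-- `a` is a DQ winner (minimal DQ score). -/
def sQWinner {m : ℕ} (S : Multiset (Vote m)) (a : Fin m) : Prop :=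
  ∀ b, sScQ S a ≤ sScQ S b

/-- `a` is a Dodgson winner (minimal Dodgson score). -/
def sDWinner {m : ℕ} (S : Multiset (Vote m)) (a : Fin m) : Prop :=
  ∀ b, sScD S a ≤ sScD S b

/-- Merge the vote `v'` into `v`. -/
def mergeVote {α : Type*} [DecidableEq α] (v v' : α) (w : α) : α := if w = v' then v else w

lemma merge_recover {α : Type*} [DecidableEq α] (v v' : α) (S : Multiset α) :
    S.map (mergeVote v v') + Multiset.replicate (S.count v') v' =
      S + Multiset.replicate (S.count v') v := by
  induction S using Multiset.induction_on with
  | empty => simp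
  | cons w S ih =>
    by_cases h : w = v'
    · subst h
      simp only [Multiset.map_cons, Multiset.count_cons_self, Multiset.replicate_succ, mergeVote,
        if_true] at ih ⊢
      rw [Multiset.cons_add, Multiset.add_cons, Multiset.cons_add, Multiset.add_cons, ih,
        Multiset.cons_swap]
    · have h2 : v' ≠ w := fun e => h e.symm
      simp only [Multiset.map_cons, Multiset.count_cons_of_ne h2, mergeVote, if_neg h] at ih ⊢
      rw [Multiset.cons_add, Multiset.cons_add, ih]

lemma snAbove_merge_same {m : ℕ} (v v' : Vote m) (x y : Fin m)
    (h : v x < v y ↔ v' x < v' y) (S : Multiset (Vote m)) :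
    snAbove (S.map (mergeVote v v')) x y = snAbove S x y := by
  unfold snAbove
  rw [Multiset.filter_map, Multiset.card_map]
  congr 1
  apply Multiset.filter_congr
  intro w _
  simp only [Function.comp, mergeVote]
  split_ifs with hw
  · subst hw; exact h
  · rfl

lemma snAbove_merge_diff {m : ℕ} (v v' : Vote m) (x y : Fin m)
    (h : v x < v y) (h' : ¬ v' x < v' y) (S : Multiset (Vote m)) :
    snAbove (S.map (mergeVote v v')) x y = snAbove S x y + S.count v' := by
  unfold snAbove
  induction S using Multiset.induction_on with
  | empty => simp
  | cons w S ih =>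
    by_cases hw : w = v'
    · subst hw
      simp [mergeVote, h, h'] at ih ⊢
      omega
    · have h2 : v' ≠ w := fun e => hw e.symm
      by_cases h3 : w x < w y
      · simp [mergeVote, hw, h2, h3, Multiset.count_cons_of_ne h2] at ih ⊢
        omega
      · simp [mergeVote, hw, h2, h3, Multiset.count_cons_of_ne h2] at ih ⊢
        omega

lemma snAbove_add {m : ℕ} (x y : Fin m) (hxy : x ≠ y) (S : Multiset (Vote m)) :
    snAbove S x y + snAbove S y x = S.card := by
  unfold snAbove
  induction S using Multiset.induction_on with
  | empty => simp
  | cons w S ih =>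
    have hne : w x ≠ w y := fun e => hxy (w.injective e)
    rcases lt_or_gt_of_ne hne with h | h
    · have h' := not_lt_of_gt h
      simp [h, h'] at ih ⊢
      omega
    · have h' := not_lt_of_gt h
      simp [h, h'] at ih ⊢
      omega

lemma exists_votes {m : ℕ} (hm : 2 ≤ m) (a b : Fin m) (hab : a ≠ b) :
    ∃ v v' : Vote m, v a < v b ∧ v' b < v' a ∧
      ∀ c, c ≠ a → c ≠ b → (v a < v c ∧ v b < v c ∧ v' a < v' c ∧ v' b < v' c) := by
  let z : Fin m := ⟨0, by omega⟩
  let o : Fin m := ⟨1, by omega⟩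
  have hzo : z ≠ o := by simp [z, o]
  obtain ⟨v, hva, hvb⟩ : ∃ v : Vote m, v a = z ∧ v b = o := by
    refine ⟨(Equiv.swap a z).trans (Equiv.swap (Equiv.swap a z b) o), ?_, ?_⟩
    · simp only [Equiv.trans_apply, Equiv.swap_apply_left]
      apply Equiv.swap_apply_of_ne_of_ne _ hzo
      intro h
      have := congrArg (Equiv.swap a z) h
      simp at this
      exact hab this
    · simp
  have key : ∀ c, c ≠ a → c ≠ b → z < v c ∧ o < v c := by
    intro c hca hcb
    have h1 : v c ≠ z := fun h => hca (v.injective (h.trans hva.symm))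
    have h2 : v c ≠ o := fun h => hcb (v.injective (h.trans hvb.symm))
    simp only [Fin.lt_def, ne_eq, Fin.ext_iff, z, o] at h1 h2 ⊢
    omega
  have hlt : z < o := by simp [z, o, Fin.lt_def]
  refine ⟨v, v.trans (Equiv.swap z o), ?_, ?_, ?_⟩
  · rw [hva, hvb]; exact hlt
  · simp only [Equiv.trans_apply, hva, hvb, Equiv.swap_apply_left, Equiv.swap_apply_right]
    exact hlt
  · intro c hca hcb
    obtain ⟨h1, h2⟩ := key c hca hcb
    simp only [Equiv.trans_apply, hva, hvb, Equiv.swap_apply_left, Equiv.swap_apply_right]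
    rw [Equiv.swap_apply_of_ne_of_ne h1.ne' h2.ne']
    exact ⟨h1, h2, h2, h1⟩

lemma sScT_split {m : ℕ} (S : Multiset (Vote m)) (a b : Fin m) (hab : a ≠ b) :
    sScT S b = sadv S a b +
      ∑ c ∈ Finset.univ.filter (fun c => c ≠ a ∧ c ≠ b), sadv S c b := by
  unfold sScT
  have : Finset.univ.filter (fun c => c ≠ b) =
      insert a (Finset.univ.filter (fun c : Fin m => c ≠ a ∧ c ≠ b)) := by
    ext c
    by_cases h : c = a <;> simp [h, hab]
  rw [this, Finset.sum_insert (by simp)]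

/-- Signed difference of Tideman scores. -/
def tDiff {m : ℕ} (a b : Fin m) (S : Multiset (Vote m)) : ℤ := (sScT S b : ℤ) - sScT S a

lemma merge_inj {m : ℕ} (a b : Fin m) (hab : a ≠ b) (v v' : Vote m)
    (h1 : v a < v b) (h2 : v' b < v' a)
    (h3 : ∀ c, c ≠ a → c ≠ b → (v a < v c ∧ v b < v c ∧ v' a < v' c ∧ v' b < v' c))
    (S T : Multiset (Vote m)) (hmap : S.map (mergeVote v v') = T.map (mergeVote v v'))
    (hd : tDiff a b S = tDiff a b T) : S = T := by
  have hcard : S.card = T.card := by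
    simpa using congrArg Multiset.card hmap
  have hn : ∀ x y : Fin m, (v x < v y ↔ v' x < v' y) → snAbove S x y = snAbove T x y := by
    intro x y h
    rw [← snAbove_merge_same v v' x y h S, hmap, snAbove_merge_same v v' x y h T]
  have hb : ∀ c, c ≠ a → c ≠ b → sadv S c b = sadv T c b := by
    intro c hca hcb
    obtain ⟨q1, q2, q3, q4⟩ := h3 c hca hcb
    unfold sadv
    rw [hn c b (iff_of_false (not_lt_of_gt q2) (not_lt_of_gt q4)), hn b c (iff_of_true q2 q4)]
  have ha : ∀ c, c ≠ a → c ≠ b → sadv S c a = sadv T c a := by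
    intro c hca hcb
    obtain ⟨q1, q2, q3, q4⟩ := h3 c hca hcb
    unfold sadv
    rw [hn c a (iff_of_false (not_lt_of_gt q1) (not_lt_of_gt q3)), hn a c (iff_of_true q1 q3)]
  have sb : ∑ c ∈ Finset.univ.filter (fun c => c ≠ a ∧ c ≠ b), sadv S c b =
      ∑ c ∈ Finset.univ.filter (fun c => c ≠ a ∧ c ≠ b), sadv T c b := by
    apply Finset.sum_congr rfl
    intro c hc
    simp only [Finset.mem_filter] at hc
    exact hb c hc.2.1 hc.2.2
  have sa : ∑ c ∈ Finset.univ.filter (fun c => c ≠ b ∧ c ≠ a), sadv S c a =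
      ∑ c ∈ Finset.univ.filter (fun c => c ≠ b ∧ c ≠ a), sadv T c a := by
    apply Finset.sum_congr rfl
    intro c hc
    simp only [Finset.mem_filter] at hc
    exact ha c hc.2.2 hc.2.1
  unfold tDiff at hd
  rw [sScT_split S a b hab, sScT_split T a b hab, sScT_split S b a hab.symm,
    sScT_split T b a hab.symm, sa, sb] at hd
  have e1 := snAbove_add a b hab S
  have e2 := snAbove_add a b hab T
  have e3 : snAbove S a b = snAbove T a b := by
    simp only [sadv] at hd
    omega
  have c1 := snAbove_merge_diff v v' a b h1 (not_lt_of_gt h2) S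
  have c2 := snAbove_merge_diff v v' a b h1 (not_lt_of_gt h2) T
  rw [hmap] at c1
  have hc : S.count v' = T.count v' := by omega
  have r1 := merge_recover v v' S
  have r2 := merge_recover v v' T
  rw [hmap, hc, r2] at r1
  exact (add_right_cancel r1).symm

lemma sScT_le {m : ℕ} (S : Multiset (Vote m)) (a : Fin m) : sScT S a ≤ 2 * sScQ S a := by
  unfold sScT sScQ
  rw [Finset.mul_sum]
  apply Finset.sum_le_sum
  intro c _
  omega

lemma sScQ_le {m : ℕ} (S : Multiset (Vote m)) (a : Fin m) : 2 * sScQ S a ≤ sScT S a + m := by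
  unfold sScT sScQ
  rw [Finset.mul_sum]
  calc _ ≤ ∑ b ∈ Finset.univ.filter (fun b => b ≠ a), (sadv S b a + 1) := by
        apply Finset.sum_le_sum
        intro c _
        omega
    _ ≤ _ := by
        rw [Finset.sum_add_distrib]
        have := Finset.card_filter_le (Finset.univ : Finset (Fin m)) (fun b => b ≠ a)
        simp at this ⊢
        omega

lemma bad_pair {m : ℕ} (S : Multiset (Vote m))
    (h : {x : Fin m | sTWinner S x} ≠ {x : Fin m | sQWinner S x}) :
    ∃ a b : Fin m, a ≠ b ∧ tDiff a b S ∈ Finset.Icc (-(m : ℤ)) m := by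
  by_contra! hc
  apply h
  ext x
  simp only [Set.mem_setOf_eq]
  constructor
  · intro hx b
    by_contra! hlt
    have hne : x ≠ b := by rintro rfl; omega
    have := hc x b hne
    have t1 := hx b
    have t2 := sScT_le S b
    have t3 := sScQ_le S x
    apply this
    simp only [tDiff, Finset.mem_Icc]
    omega
  · intro hx b
    by_contra! hlt
    have hne : x ≠ b := by rintro rfl; omega
    have := hc x b hne
    have t1 := hx b
    have t2 := sScT_le S x
    have t3 := sScQ_le S b
    apply this
    simp only [tDiff, Finset.mem_Icc]
    omega

lemma pair_count {m : ℕ} (hm : 2 ≤ m) (n : ℕ) (a b : Fin m) (hab : a ≠ b) :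
    (Finset.univ.filter (fun S : Sym (Vote m) n =>
      tDiff a b (S : Multiset (Vote m)) ∈ Finset.Icc (-(m : ℤ)) m)).card ≤
      (2 * m + 1) * Nat.multichoose (m.factorial - 1) n := by
  obtain ⟨v, v', h1, h2, h3⟩ := exists_votes hm a b hab
  have hvv : v ≠ v' := by rintro rfl; exact lt_asymm h1 h2
  let g : Vote m → {w : Vote m // w ≠ v'} := fun w =>
    ⟨mergeVote v v' w, by unfold mergeVote; split_ifs with h <;> assumption⟩
  have hcard : Fintype.card {w : Vote m // w ≠ v'} = m.factorial - 1 := by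
    rw [Fintype.card_subtype_compl, Fintype.card_perm]
    simp
  let t : Finset (ℤ × Sym {w : Vote m // w ≠ v'} n) := Finset.Icc (-(m : ℤ)) m ×ˢ Finset.univ
  have ht : t.card = (2 * m + 1) * Nat.multichoose (m.factorial - 1) n := by
    rw [Finset.card_product, Finset.card_univ, Sym.card_sym_eq_multichoose, hcard, Int.card_Icc]
    congr 1
    omega
  rw [← ht]
  apply Finset.card_le_card_of_injOn
    (fun S : Sym (Vote m) n => (tDiff a b (S : Multiset (Vote m)), S.map g))
  · intro S hS
    simp only [Finset.coe_filter, Set.mem_setOf_eq] at hS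
    simp only [t, Finset.coe_product, Set.mem_prod, Finset.mem_coe]
    exact ⟨hS.2, Finset.mem_univ _⟩
  · intro S _ T _ hST
    simp only [Prod.mk.injEq] at hST
    apply Sym.coe_injective
    apply merge_inj a b hab v v' h1 h2 h3 _ _ _ hST.1
    have := congrArg (fun U : Sym {w : Vote m // w ≠ v'} n =>
      (U : Multiset {w : Vote m // w ≠ v'}).map Subtype.val) hST.2
    simpa [Sym.coe_map, Multiset.map_map, Function.comp_def, g] using this

lemma bad_count {m : ℕ} (hm : 2 ≤ m) (n : ℕ) :
    Set.ncard {S : Sym (Vote m) n |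
            {x : Fin m | sTWinner (S : Multiset (Vote m)) x} ≠
            {x : Fin m | sQWinner (S : Multiset (Vote m)) x}} ≤
      (m * m) * ((2 * m + 1) * Nat.multichoose (m.factorial - 1) n) := by
  classical
  let U : Finset (Sym (Vote m) n) :=
    (Finset.univ.filter (fun p : Fin m × Fin m => p.1 ≠ p.2)).biUnion (fun p =>
      Finset.univ.filter (fun S : Sym (Vote m) n =>
        tDiff p.1 p.2 (S : Multiset (Vote m)) ∈ Finset.Icc (-(m : ℤ)) m))
  calc _ ≤ Set.ncard (U : Set (Sym (Vote m) n)) := by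
        apply Set.ncard_le_ncard _ (Finset.finite_toSet _)
        intro S hS
        obtain ⟨a, b, hab, h⟩ := bad_pair _ hS
        simp only [U, Finset.mem_coe, Finset.mem_biUnion]
        refine ⟨(a, b), ?_, ?_⟩
        · simpa using hab
        · exact Finset.mem_filter.2 ⟨Finset.mem_univ _, h⟩
    _ = U.card := Set.ncard_coe_finset _
    _ ≤ (Finset.univ.filter (fun p : Fin m × Fin m => p.1 ≠ p.2)).card *
          ((2 * m + 1) * Nat.multichoose (m.factorial - 1) n) := by
        apply Finset.card_biUnion_le_card_mul
        intro p hp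
        exact pair_count hm n p.1 p.2 (Finset.mem_filter.1 hp).2
    _ ≤ _ := by
        apply Nat.mul_le_mul_right
        refine (Finset.card_filter_le _ _).trans ?_
        simp

lemma ratio_eq (M n : ℕ) (hM : 2 ≤ M) :
    (Nat.multichoose (M - 1) n : ℝ) / Nat.choose (n + M - 1) n = (M - 1) / (n + M - 1) := by
  obtain ⟨k, rfl⟩ : ∃ k, M = k + 2 := ⟨M - 2, by omega⟩
  rw [Nat.multichoose_eq]
  have e1 : k + 2 - 1 + n - 1 = n + k := by omega
  have e2 : n + (k + 2) - 1 = n + k + 1 := by omega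
  rw [e1, e2]
  have h := Nat.choose_mul_succ_eq (n + k) n
  have e3 : n + k + 1 - n = k + 1 := by omega
  rw [e3] at h
  have h' : ((n + k).choose n : ℝ) * (n + k + 1) = (n + k + 1).choose n * (k + 1) := by
    exact_mod_cast h
  have hpos : (0 : ℝ) < (n + k + 1).choose n := by
    exact_mod_cast Nat.choose_pos (by omega)
  push_cast
  have hne : (n : ℝ) + (k + 2) - 1 ≠ 0 := by
    have : (n : ℝ) + (k + 2) - 1 = n + k + 1 := by ring
    rw [this]; positivity
  rw [div_eq_div_iff hpos.ne' hne]
  linear_combination h'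

/-- Under the Impartial Anonymous Culture assumption the probability that the
Tideman and DQ rules pick the same set of winners converges to 1: the
proportion, among all `C(n + m! − 1, n)` voting situations with `n` agents, of
those in which the set of Tideman winners differs from the set of DQ winners
tends to `0` as `n → ∞`. -/
theorem stmt_9 {m : ℕ} (hm : 2 ≤ m) :
    Filter.Tendsto (fun n : ℕ =>
        (Set.ncard {S : Sym (Vote m) n |
            {x : Fin m | sTWinner (S : Multiset (Vote m)) x} ≠
            {x : Fin m | sQWinner (S : Multiset (Vote m)) x}} : ℝ) /
          Nat.choose (n + Nat.factorial m - 1) n)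
      Filter.atTop (nhds 0) := by
  have hM : 2 ≤ m.factorial := hm.trans (Nat.self_le_factorial m)
  set C : ℝ := (m * m) * (2 * m + 1) * ((m.factorial : ℝ) - 1) with hC
  have hlim : Filter.Tendsto (fun n : ℕ => C / ((n : ℝ) + ((m.factorial : ℝ) - 1)))
      Filter.atTop (nhds 0) :=
    Filter.Tendsto.const_div_atTop
      (Filter.tendsto_atTop_add_const_right _ _ tendsto_natCast_atTop_atTop) _
  refine squeeze_zero (fun n => by positivity) (fun n => ?_) hlim
  have hb := bad_count hm n
  have hr := ratio_eq m.factorial n hM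
  have hb' : (Set.ncard {S : Sym (Vote m) n |
            {x : Fin m | sTWinner (S : Multiset (Vote m)) x} ≠
            {x : Fin m | sQWinner (S : Multiset (Vote m)) x}} : ℝ) ≤
      (m * m) * (2 * m + 1) * (Nat.multichoose (m.factorial - 1) n : ℝ) := by
    rw [mul_assoc]
    exact_mod_cast hb
  refine (div_le_div_of_nonneg_right hb' (by positivity)).trans (le_of_eq ?_)
  rw [mul_div_assoc, hr, hC, mul_div_assoc, add_sub_assoc]
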